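/- For every integer k ≥ 1, every ρ > 0 and every y ∈ ℝ^{k+1}, the Gaussian area of the sphere of radius ρ centered at y satisfies F(∂B_ρ(y)) ≤ F(∂B_{√(2k)}(0)); that is, (4π)^{-k/2} ∫_{∂B_ρ(y)} e^{-|x|²/4} dH^k ≤ (4π)^{-k/2} ∫_{∂B_{√(2k)}(0)} e^{-|x|²/4} dH^k. -/

import Mathlib

open MeasureTheory Metric

section Auxiliary

open scoped RealInnerProductSpace Nat Pointwise

/-- Hermite–Hadamard for the logarithm, in multiplicative form. -/
lemma exp_mul_log_sub_succ_le {x : ℝ} (hx : 0 < x) :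
    Real.exp ((x + 1) * Real.log (x + 1) - (x + 1)) ≤
      (x + 1 / 2) * Real.exp (x * Real.log x - x) := by
  have hs : 0 < x + 1 / 2 := by linarith
  have hmono : ∫ u in x..(x + 1), Real.log u ≤
      ∫ u in x..(x + 1), (Real.log (x + 1 / 2) + (u / (x + 1 / 2) - 1)) := by
    refine intervalIntegral.integral_mono_on (by linarith) intervalIntegral.intervalIntegrable_log'
      (Continuous.intervalIntegrable (by fun_prop) _ _) fun u hu ↦ ?_
    have hu0 : 0 < u := hx.trans_le hu.1
    have h := Real.log_le_sub_one_of_pos (div_pos hu0 hs)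
    rw [Real.log_div hu0.ne' hs.ne'] at h
    linarith
  have hright : ∫ u in x..(x + 1), (Real.log (x + 1 / 2) + (u / (x + 1 / 2) - 1)) =
      Real.log (x + 1 / 2) := by
    rw [intervalIntegral.integral_add (by simp)
      (Continuous.intervalIntegrable (by fun_prop) _ _), intervalIntegral.integral_sub
      (Continuous.intervalIntegrable (by fun_prop) _ _) (by simp),
      intervalIntegral.integral_div, integral_id]
    simp only [intervalIntegral.integral_const, smul_eq_mul]
    field_simp
    ring
  rw [hright, integral_log] at hmono
  calc _ ≤ Real.exp (Real.log (x + 1 / 2) + (x * Real.log x - x)) := by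
        gcongr; linarith
    _ = _ := by rw [Real.exp_add, Real.exp_log hs]

lemma rpow_mul_exp_neg_le {a x : ℝ} (ha : 0 < a) (hx : 0 < x) :
    a ^ x * Real.exp (-a) ≤ Real.exp (x * Real.log x - x) := by
  rw [Real.rpow_def_of_pos ha, ← Real.exp_add]
  gcongr
  have h := Real.log_le_sub_one_of_pos (div_pos ha hx)
  rw [Real.log_div ha.ne' hx.ne'] at h
  have h2 := mul_le_mul_of_nonneg_left h hx.le
  have h3 : x * (a / x - 1) = a - x := by field_simp
  nlinarith

section Invariant

variable {k : ℕ} {μ : Measure (EuclideanSpace ℝ (Fin (k + 1)))}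

lemma integral_comp_linearIsometryEquiv
    (hinv : ∀ R : EuclideanSpace ℝ (Fin (k + 1)) ≃ₗᵢ[ℝ] EuclideanSpace ℝ (Fin (k + 1)),
      MeasurePreserving R μ μ)
    (R : EuclideanSpace ℝ (Fin (k + 1)) ≃ₗᵢ[ℝ] EuclideanSpace ℝ (Fin (k + 1)))
    (g : EuclideanSpace ℝ (Fin (k + 1)) → ℝ) : ∫ ω, g (R ω) ∂μ = ∫ ω, g ω ∂μ :=
  (hinv R).integral_comp R.toHomeomorph.measurableEmbedding g

lemma integral_inner_pow_mul_inner_eq_zero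
    (hinv : ∀ R : EuclideanSpace ℝ (Fin (k + 1)) ≃ₗᵢ[ℝ] EuclideanSpace ℝ (Fin (k + 1)),
      MeasurePreserving R μ μ)
    {v w : EuclideanSpace ℝ (Fin (k + 1))} (hvw : ⟪w, v⟫ = 0) (p : ℕ) :
    ∫ ω, ⟪v, ω⟫ ^ p * ⟪w, ω⟫ ∂μ = 0 := by
  set R := (ℝ ∙ w)ᗮ.reflection
  have hv : R v = v := Submodule.reflection_mem_subspace_eq_self
    (Submodule.mem_orthogonal_singleton_iff_inner_right.2 hvw)
  have hw : R w = -w := Submodule.reflection_orthogonalComplement_singleton_eq_neg w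
  have h := integral_comp_linearIsometryEquiv hinv R fun ω ↦ ⟪v, ω⟫ ^ p * ⟪w, ω⟫
  have h1 (ω) : ⟪v, R ω⟫ = ⟪v, ω⟫ := by rw [← R.inner_map_map v ω, hv]
  have h2 (ω) : ⟪w, R ω⟫ = -⟪w, ω⟫ := by rw [← R.inner_map_map w ω, hw, inner_neg_left, neg_neg]
  simp only [h1, h2, mul_neg, integral_neg] at h
  linarith

variable [IsFiniteMeasure μ]

lemma integrable_of_continuous_of_ae_norm_eq_one (hsph : ∀ᵐ ω ∂μ, ‖ω‖ = 1)
    {g : EuclideanSpace ℝ (Fin (k + 1)) → ℝ} (hg : Continuous g) : Integrable g μ := by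
  obtain ⟨C, hC⟩ := (isCompact_sphere (0 : EuclideanSpace ℝ (Fin (k + 1)))
    1).exists_bound_of_continuousOn
    hg.continuousOn
  refine Integrable.of_bound hg.aestronglyMeasurable C ?_
  filter_upwards [hsph] with ω hω using hC ω (by simpa using hω)

lemma integral_pow_mul_sq_eq (hsph : ∀ᵐ ω ∂μ, ‖ω‖ = 1)
    (hinv : ∀ R : EuclideanSpace ℝ (Fin (k + 1)) ≃ₗᵢ[ℝ] EuclideanSpace ℝ (Fin (k + 1)),
      MeasurePreserving R μ μ) {i : Fin (k + 1)} (hi : i ≠ 0) (m : ℕ) :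
    (2 * m + 1) * ∫ ω, ω 0 ^ (2 * m) * ω i ^ 2 ∂μ = ∫ ω, ω 0 ^ (2 * m + 2) ∂μ := by
  let F (t : ℝ) (ω : EuclideanSpace ℝ (Fin (k + 1))) : ℝ :=
    (ω 0 + t * ω i) ^ (2 * m + 1) * (ω i - t * ω 0)
  let F' (t : ℝ) (ω : EuclideanSpace ℝ (Fin (k + 1))) : ℝ :=
    (2 * m + 1) * (ω 0 + t * ω i) ^ (2 * m) * ω i * (ω i - t * ω 0) +
      (ω 0 + t * ω i) ^ (2 * m + 1) * (-ω 0)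
  have hF : ∀ t, ∫ ω, F t ω ∂μ = 0 := by
    intro t
    have := integral_inner_pow_mul_inner_eq_zero hinv
      (v := EuclideanSpace.single 0 1 + t • EuclideanSpace.single i 1)
      (w := EuclideanSpace.single i 1 - t • EuclideanSpace.single 0 1)
      (by simp [inner_add_right, inner_sub_left, inner_smul_left, inner_smul_right, hi,
        EuclideanSpace.inner_single_left, hi.symm]) (2 * m + 1)
    simpa [inner_add_left, inner_sub_left, inner_smul_left, EuclideanSpace.inner_single_left]
      using this
  have hderiv := (hasDerivAt_integral_of_dominated_loc_of_deriv_le (μ := μ) (F := F) (F' := F')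
    (x₀ := (0 : ℝ)) (s := Metric.ball 0 1)
    (bound := fun _ ↦ (2 * m + 1) * 2 ^ (2 * m) * 1 * 2 + 2 ^ (2 * m + 1) * 1)
    (Metric.ball_mem_nhds _ one_pos)
    (.of_forall fun t ↦ Continuous.aestronglyMeasurable (by fun_prop))
    (integrable_of_continuous_of_ae_norm_eq_one hsph (by fun_prop))
    (Continuous.aestronglyMeasurable (by fun_prop)) ?_ (integrable_const _) ?_).2
  · simp only [hF] at hderiv
    have h0 := hderiv.unique (hasDerivAt_const (0 : ℝ) (0 : ℝ))
    simp only [F', zero_mul, add_zero, sub_zero] at h0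
    rw [integral_add (integrable_of_continuous_of_ae_norm_eq_one hsph (by fun_prop))
      (integrable_of_continuous_of_ae_norm_eq_one hsph (by fun_prop))] at h0
    simp only [mul_neg, integral_neg, ← pow_succ] at h0
    rw [← integral_const_mul, ← sub_eq_zero, sub_eq_add_neg, ← h0]
    simp only [mul_assoc, sq]
  · filter_upwards [hsph] with ω hω t ht
    have h0 : |ω 0| ≤ 1 := hω ▸ PiLp.norm_apply_le ω 0
    have h1 : |ω i| ≤ 1 := hω ▸ PiLp.norm_apply_le ω i
    have ht : |t| ≤ 1 := by simpa using (mem_ball_zero_iff.1 ht).le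
    have ha : |ω 0 + t * ω i| ≤ 2 := (abs_add_le _ _).trans (by
      rw [abs_mul]; nlinarith [abs_nonneg t, abs_nonneg (ω i)])
    have hb : |ω i - t * ω 0| ≤ 2 := (abs_sub _ _).trans (by
      rw [abs_mul]; nlinarith [abs_nonneg t, abs_nonneg (ω 0)])
    refine (norm_add_le _ _).trans ?_
    simp only [Real.norm_eq_abs, abs_mul, abs_pow, abs_neg]
    rw [abs_of_nonneg (by positivity : (0 : ℝ) ≤ 2 * m + 1)]
    gcongr
  · refine .of_forall fun ω t _ ↦ ?_
    have h1 : HasDerivAt (fun t ↦ ω 0 + t * ω i) (ω i) t := by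
      simpa using ((hasDerivAt_id t).mul_const (ω i)).const_add (ω 0)
    have h2 : HasDerivAt (fun t ↦ ω i - t * ω 0) (-ω 0) t := by
      simpa using ((hasDerivAt_id t).mul_const (ω 0)).const_sub (ω i)
    exact ((h1.pow (2 * m + 1)).mul h2).congr_deriv (by simp [F'])

lemma integral_pow_succ_eq (hsph : ∀ᵐ ω ∂μ, ‖ω‖ = 1)
    (hinv : ∀ R : EuclideanSpace ℝ (Fin (k + 1)) ≃ₗᵢ[ℝ] EuclideanSpace ℝ (Fin (k + 1)),
      MeasurePreserving R μ μ) (m : ℕ) :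
    (2 * m + 1) * ∫ ω, ω 0 ^ (2 * m) ∂μ = (2 * m + 1 + k) * ∫ ω, ω 0 ^ (2 * m + 2) ∂μ := by
  have hsum : ∫ ω, ω 0 ^ (2 * m) ∂μ = ∑ i, ∫ ω, ω 0 ^ (2 * m) * ω i ^ 2 ∂μ := by
    rw [← integral_finsetSum _ fun i _ ↦
      integrable_of_continuous_of_ae_norm_eq_one hsph (by fun_prop)]
    refine integral_congr_ae ?_
    filter_upwards [hsph] with ω hω
    rw [← Finset.mul_sum, ← EuclideanSpace.real_norm_sq_eq, hω]
    simp
  rw [hsum, Fin.sum_univ_succ, mul_add, Finset.mul_sum,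
    Finset.sum_congr rfl fun i _ ↦ integral_pow_mul_sq_eq hsph hinv (Fin.succ_ne_zero i) m]
  simp only [← pow_add, Finset.sum_const, Finset.card_univ, Fintype.card_fin, nsmul_eq_mul]
  ring

lemma hasSum_integral_exp (hsph : ∀ᵐ ω ∂μ, ‖ω‖ = 1)
    (hinv : ∀ R : EuclideanSpace ℝ (Fin (k + 1)) ≃ₗᵢ[ℝ] EuclideanSpace ℝ (Fin (k + 1)),
      MeasurePreserving R μ μ) (t : ℝ) :
    HasSum (fun m : ℕ ↦ t ^ (2 * m) / (2 * m)! * ∫ ω, ω 0 ^ (2 * m) ∂μ)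
      (∫ ω, Real.exp (t * ω 0) ∂μ) := by
  have hint {g : EuclideanSpace ℝ (Fin (k + 1)) → ℝ} (hg : Continuous g) : Integrable g μ :=
    integrable_of_continuous_of_ae_norm_eq_one hsph hg
  have hneg := integral_comp_linearIsometryEquiv hinv (LinearIsometryEquiv.neg ℝ)
    fun ω ↦ Real.exp (t * ω 0)
  have hcosh : ∫ ω, Real.exp (t * ω 0) ∂μ = ∫ ω, Real.cosh (t * ω 0) ∂μ := by
    simp only [Real.cosh_eq, integral_div]
    rw [integral_add (hint (by fun_prop)) (hint (by fun_prop))]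
    simp only [LinearIsometryEquiv.coe_neg, PiLp.neg_apply, mul_neg] at hneg
    rw [hneg]
    ring
  rw [hcosh]
  simp only [← integral_const_mul]
  refine hasSum_integral_of_dominated_convergence
    (fun m _ ↦ |t| ^ (2 * m) / (2 * m)!) (fun m ↦ (hint (by fun_prop)).aestronglyMeasurable)
    (fun m ↦ ?_) ?_ (integrable_const _) (.of_forall fun ω ↦ ?_)
  · filter_upwards [hsph] with ω hω
    have h0 : |ω 0| ≤ 1 := hω ▸ PiLp.norm_apply_le ω 0
    simp only [Real.norm_eq_abs, abs_mul, abs_pow, abs_div, Nat.abs_cast]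
    exact mul_le_of_le_one_right (by positivity) (pow_le_one₀ (abs_nonneg _) h0)
  · exact .of_forall fun _ ↦ (Real.hasSum_cosh |t|).summable
  · simpa only [mul_pow, mul_div_right_comm] using Real.hasSum_cosh (t * ω 0)


lemma moment_mul_exp_le (hk : 0 < k) (hsph : ∀ᵐ ω ∂μ, ‖ω‖ = 1)
    (hinv : ∀ R : EuclideanSpace ℝ (Fin (k + 1)) ≃ₗᵢ[ℝ] EuclideanSpace ℝ (Fin (k + 1)),
      MeasurePreserving R μ μ) (m : ℕ) :
    4 ^ m * m ! / (2 * m)! * (∫ ω, ω 0 ^ (2 * m) ∂μ) *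
        Real.exp ((k / 2 + m) * Real.log (k / 2 + m) - (k / 2 + m)) ≤
      μ.real Set.univ * Real.exp (k / 2 * Real.log (k / 2) - k / 2) := by
  induction m with
  | zero => simp
  | succ m ih =>
    refine le_trans ?_ ih
    have hx : (0 : ℝ) < k / 2 + m := by positivity
    have hrec := integral_pow_succ_eq hsph hinv m
    set c := ∫ ω, ω 0 ^ (2 * m) ∂μ
    have hc : 0 ≤ c := integral_nonneg fun ω ↦ by simp only [pow_mul]; positivity
    have hc' : ∫ ω, ω 0 ^ (2 * (m + 1)) ∂μ = (2 * m + 1) * c / (2 * m + 1 + k) := by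
      rw [hrec, show 2 * (m + 1) = 2 * m + 2 by ring]
      field_simp
    have hcoef : 4 ^ (m + 1) * (m + 1)! / (2 * (m + 1))! * ∫ ω, ω 0 ^ (2 * (m + 1)) ∂μ =
        4 ^ m * m ! / (2 * m)! * c / (k / 2 + m + 1 / 2) := by
      rw [hc', show 2 * (m + 1) = 2 * m + 1 + 1 by ring]
      simp only [Nat.factorial_succ]
      push_cast
      field_simp
      ring
    have hexp := exp_mul_log_sub_succ_le hx
    rw [hcoef, div_mul_eq_mul_div, div_le_iff₀ (by positivity), mul_assoc _ (Real.exp _)]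
    push_cast
    rw [← add_assoc, mul_comm (Real.exp _)]
    gcongr

lemma two_pow_mul_rpow (k : ℕ) {ρ : ℝ} (hρ : 0 ≤ ρ) :
    2 ^ k * (ρ ^ 2 / 4) ^ ((k : ℝ) / 2) = ρ ^ k := by
  rw [show ρ ^ 2 / 4 = (ρ / 2) ^ 2 by ring, ← Real.rpow_natCast_mul (by positivity),
    show ((2 : ℕ) : ℝ) * (k / 2) = k by push_cast; ring, Real.rpow_natCast, ← mul_pow]
  congr 1
  ring

lemma pow_mul_exp_mul_integral_exp_le (hk : 0 < k) (hsph : ∀ᵐ ω ∂μ, ‖ω‖ = 1)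
    (hinv : ∀ R : EuclideanSpace ℝ (Fin (k + 1)) ≃ₗᵢ[ℝ] EuclideanSpace ℝ (Fin (k + 1)),
      MeasurePreserving R μ μ) {ρ : ℝ} (hρ : 0 < ρ) (r : ℝ) :
    ρ ^ k * (Real.exp (-(ρ ^ 2 / 4)) * Real.exp (-(r ^ 2 / 4)) *
        ∫ ω, Real.exp (ρ * r / 2 * ω 0) ∂μ) ≤
      √(2 * k) ^ k * (Real.exp (-(k / 2)) * μ.real Set.univ) := by
  have hk' : (0 : ℝ) < k / 2 := by positivity
  have hopt : √(2 * k) ^ k * Real.exp (-(k / 2)) =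
      2 ^ k * Real.exp (k / 2 * Real.log (k / 2) - k / 2) := by
    rw [← two_pow_mul_rpow k (Real.sqrt_nonneg _), Real.sq_sqrt (by positivity),
      show 2 * (k : ℝ) / 4 = k / 2 by ring, Real.rpow_def_of_pos hk', mul_assoc, ← Real.exp_add,
      mul_comm (Real.log _), sub_eq_add_neg]
  set S := Real.exp (k / 2 * Real.log (k / 2) - k / 2)
  have hsum := ((hasSum_integral_exp hsph hinv (ρ * r / 2)).mul_left
    (Real.exp (-(ρ ^ 2 / 4)) * Real.exp (-(r ^ 2 / 4)))).mul_left (ρ ^ k)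
  have hexp : HasSum (fun m : ℕ ↦ 2 ^ k * (μ.real Set.univ * S) * Real.exp (-(r ^ 2 / 4)) *
      ((r ^ 2 / 4) ^ m / m !)) (2 ^ k * (μ.real Set.univ * S) * Real.exp (-(r ^ 2 / 4)) *
        Real.exp (r ^ 2 / 4)) := by
    have := NormedSpace.expSeries_div_hasSum_exp (r ^ 2 / 4)
    rw [← Real.exp_eq_exp_ℝ] at this
    exact this.mul_left _
  rw [← mul_assoc (√(2 * k) ^ k), hopt]
  have heq : 2 ^ k * (μ.real Set.univ * S) * Real.exp (-(r ^ 2 / 4)) * Real.exp (r ^ 2 / 4) =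
      2 ^ k * S * μ.real Set.univ := by
    rw [mul_assoc, ← Real.exp_add, neg_add_cancel, Real.exp_zero]
    ring
  rw [← heq]
  refine hasSum_le (fun m ↦ ?_) hsum hexp
  have ha : 0 < ρ ^ 2 / 4 := by positivity
  have hmom := moment_mul_exp_le hk hsph hinv m
  have hc : 0 ≤ ∫ ω, ω 0 ^ (2 * m) ∂μ := integral_nonneg fun ω ↦ by
    simp only [pow_mul]; positivity
  have hpow := rpow_mul_exp_neg_le ha (by positivity : (0 : ℝ) < k / 2 + m)
  rw [Real.rpow_add_natCast ha.ne'] at hpow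
  set c := ∫ ω, ω 0 ^ (2 * m) ∂μ
  calc _ = 2 ^ k * (4 ^ m * m ! / (2 * m)! * c *
          ((ρ ^ 2 / 4) ^ ((k : ℝ) / 2) * (ρ ^ 2 / 4) ^ m * Real.exp (-(ρ ^ 2 / 4)))) *
          Real.exp (-(r ^ 2 / 4)) * ((r ^ 2 / 4) ^ m / m !) := by
        rw [← two_pow_mul_rpow k hρ.le, pow_mul,
          show (ρ * r / 2) ^ 2 = 4 * (ρ ^ 2 / 4) * (r ^ 2 / 4) by ring, mul_pow, mul_pow]
        field_simp
    _ ≤ _ := by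
        have hle := (mul_le_mul_of_nonneg_left hpow
          (by positivity : 0 ≤ 4 ^ m * m ! / (2 * m)! * c)).trans hmom
        gcongr

end Invariant

/-- The Hausdorff measure on the unit sphere. -/
noncomputable def sphereMeasure (k : ℕ) : Measure (EuclideanSpace ℝ (Fin (k + 1))) :=
  μH[(k : ℝ)].restrict (sphere 0 1)

lemma ae_norm_eq_one_sphereMeasure (k : ℕ) : ∀ᵐ ω ∂sphereMeasure k, ‖ω‖ = 1 := by
  filter_upwards [ae_restrict_mem isClosed_sphere.measurableSet] with ω hω
  simpa using hω

lemma measurePreserving_sphereMeasure (k : ℕ)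
    (R : EuclideanSpace ℝ (Fin (k + 1)) ≃ₗᵢ[ℝ] EuclideanSpace ℝ (Fin (k + 1))) :
    MeasurePreserving R (sphereMeasure k) (sphereMeasure k) := by
  have h := (R.toIsometryEquiv.measurePreserving_hausdorffMeasure (k : ℝ)).restrict_preimage
    (isClosed_sphere (x := (0 : EuclideanSpace ℝ (Fin (k + 1)))) (ε := 1)).measurableSet
  have hpre : R.toIsometryEquiv ⁻¹' sphere 0 1 = sphere 0 1 := by
    rw [IsometryEquiv.preimage_sphere]
    simp
  rwa [hpre] at h

lemma setIntegral_sphere_eq {k : ℕ} {ρ : ℝ} (hρ : 0 < ρ)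
    (y : EuclideanSpace ℝ (Fin (k + 1))) (f : EuclideanSpace ℝ (Fin (k + 1)) → ℝ) :
    ∫ x in sphere y ρ, f x ∂μH[(k : ℝ)] = ρ ^ k * ∫ ω, f (ρ • ω + y) ∂sphereMeasure k := by
  have hρ0 := hρ.ne'
  let g : EuclideanSpace ℝ (Fin (k + 1)) ≃ₜ EuclideanSpace ℝ (Fin (k + 1)) :=
    (Homeomorph.smulOfNeZero ρ hρ0).trans (Homeomorph.addRight y)
  have hg (ω) : g ω = ρ • ω + y := rfl
  have hpre : g ⁻¹' sphere y ρ = sphere 0 1 := by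
    ext ω
    simp [hg, norm_smul, abs_of_pos hρ, hρ0]
  have hmap : (μH[(k : ℝ)]).restrict (sphere y ρ) =
      (ρ.toNNReal ^ k) • (sphereMeasure k).map g := by
    rw [sphereMeasure, ← hpre, ← Measure.restrict_map g.measurable isClosed_sphere.measurableSet,
      ← Measure.restrict_smul]
    congr 1
    ext s hs
    rw [Measure.smul_apply, Measure.map_apply g.measurable hs]
    conv_lhs => rw [← g.image_preimage s]
    have himg : g '' (g ⁻¹' s) = IsometryEquiv.addRight y '' (ρ • (g ⁻¹' s)) := by
      rw [← Set.image_smul, Set.image_image]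
      rfl
    rw [himg, IsometryEquiv.hausdorffMeasure_image,
      Measure.hausdorffMeasure_smul₀ (Nat.cast_nonneg k) hρ0, NNReal.rpow_natCast,
      Real.nnnorm_of_nonneg hρ.le, Real.toNNReal_of_nonneg hρ.le]
  rw [hmap, integral_smul_nnreal_measure, g.measurableEmbedding.integral_map]
  simp [NNReal.smul_def, hρ.le, hg]

/-- The Gaussian area of a sphere in terms of an exponential moment on the unit sphere. -/
lemma integral_exp_neg_norm_sq_eq {k : ℕ} (ρ : ℝ) (y : EuclideanSpace ℝ (Fin (k + 1))) :
    ∫ ω, Real.exp (-‖ρ • ω + y‖ ^ 2 / 4) ∂sphereMeasure k =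
      Real.exp (-(ρ ^ 2 / 4)) * Real.exp (-(‖y‖ ^ 2 / 4)) *
        ∫ ω, Real.exp (ρ * ‖y‖ / 2 * ω 0) ∂sphereMeasure k := by
  set z := ‖y‖ • (-EuclideanSpace.single 0 1 : EuclideanSpace ℝ (Fin (k + 1))) with hz
  have hnorm : ‖y‖ = ‖z‖ := by simp [hz, norm_smul]
  set R := (ℝ ∙ (y - z))ᗮ.reflection
  have hRy : R y = z := Submodule.reflection_sub hnorm
  rw [← integral_const_mul, ← integral_comp_linearIsometryEquiv (measurePreserving_sphereMeasure k)
    R fun ω ↦ _ * Real.exp (ρ * ‖y‖ / 2 * ω 0)]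
  refine integral_congr_ae ?_
  filter_upwards [ae_norm_eq_one_sphereMeasure k] with ω hω
  have hin : ⟪ω, y⟫ = -(‖y‖ * R ω 0) := by
    rw [← R.inner_map_map, hRy, hz]
    simp [inner_smul_right, EuclideanSpace.inner_single_right]
  rw [← Real.exp_add, ← Real.exp_add, norm_add_sq_real, norm_smul, hω, inner_smul_left, hin]
  congr 1
  simp
  ring

lemma setIntegral_sphere_exp_le {k : ℕ} (hk : 0 < k) {ρ : ℝ} (hρ : 0 < ρ)
    (y : EuclideanSpace ℝ (Fin (k + 1))) :
    ∫ x in sphere y ρ, Real.exp (-‖x‖ ^ 2 / 4) ∂μH[(k : ℝ)] ≤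
      ∫ x in sphere (0 : EuclideanSpace ℝ (Fin (k + 1))) √(2 * k),
        Real.exp (-‖x‖ ^ 2 / 4) ∂μH[(k : ℝ)] := by
  have hsqrt : 0 < √(2 * (k : ℝ)) := by positivity
  rw [setIntegral_sphere_eq hρ, setIntegral_sphere_eq hsqrt, integral_exp_neg_norm_sq_eq,
    integral_exp_neg_norm_sq_eq]
  by_cases hfin : IsFiniteMeasure (sphereMeasure k)
  · refine (pow_mul_exp_mul_integral_exp_le hk (ae_norm_eq_one_sphereMeasure k)
      (measurePreserving_sphereMeasure k) hρ ‖y‖).trans_eq ?_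
    rw [Real.sq_sqrt (by positivity), show 2 * (k : ℝ) / 4 = k / 2 by ring]
    simp
  · have hnot : ¬ Integrable (fun ω ↦ Real.exp (ρ * ‖y‖ / 2 * ω 0)) (sphereMeasure k) := by
      intro hint
      have hone : Integrable (fun _ ↦ (1 : ℝ)) (sphereMeasure k) := by
        refine (hint.const_mul (Real.exp (ρ * ‖y‖ / 2))).mono' (by fun_prop) ?_
        filter_upwards [ae_norm_eq_one_sphereMeasure k] with ω hω
        have h0 : |ω 0| ≤ 1 := hω ▸ PiLp.norm_apply_le ω 0
        rw [norm_one, ← Real.exp_add, Real.one_le_exp_iff]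
        have : 0 ≤ ρ * ‖y‖ / 2 := by positivity
        nlinarith [neg_le_of_abs_le h0]
      exact hfin ((integrable_const_iff_isFiniteMeasure one_ne_zero).1 hone)
    rw [integral_undef hnot]
    simp only [mul_zero]
    positivity

end Auxiliary

/-- The entropy of the round `k`-sphere is achieved by the centered sphere of radius
`√(2k)`: for every `ρ > 0` and `y ∈ ℝ^{k+1}`,
`F(∂B_ρ(y)) ≤ F(∂B_{√(2k)}(0))`, where `F` is the Gaussian area. -/
theorem stmt_5 (k : ℕ) (hk : 1 ≤ k) (ρ : ℝ) (hρ : 0 < ρ)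
    (y : EuclideanSpace ℝ (Fin (k + 1))) :
    (4 * Real.pi) ^ (-(k : ℝ) / 2) *
        ∫ x in sphere y ρ, Real.exp (-‖x‖ ^ 2 / 4) ∂μH[(k : ℝ)] ≤
      (4 * Real.pi) ^ (-(k : ℝ) / 2) *
        ∫ x in sphere (0 : EuclideanSpace ℝ (Fin (k + 1))) (Real.sqrt (2 * k)),
          Real.exp (-‖x‖ ^ 2 / 4) ∂μH[(k : ℝ)] := by
  exact mul_le_mul_of_nonneg_left (setIntegral_sphere_exp_le hk hρ y) (by positivity)
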